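/- There exist ε > 0 and constants 0 < c ≤ C such that for every parameter w = (a,b) with a_k > 0 for all k, |a_k − a*_k| < ε for 2 ≤ k ≤ K*, a_k < ε for K* < k ≤ K, and ‖b_k − b*_k‖ < ε for 1 ≤ k ≤ K*, one has c·Ĥ(w) ≤ H_XY(w) ≤ C·Ĥ(w), where Ĥ(w) = Σ_{k=2}^{K*} (a_k − a*_k)² + Σ_{k=K*+1}^{K} a_k + Σ_{k=1}^{K*} ‖b_k − b*_k‖². -/

import Mathlib

open MeasureTheory

/-- The `N`-dimensional Gaussian density with mean `b` and identity covariance. -/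
noncomputable def gaussDensity (N : ℕ) (b x : EuclideanSpace ℝ (Fin N)) : ℝ :=
  (2 * Real.pi) ^ (-(N : ℝ) / 2) * Real.exp (-‖x - b‖ ^ 2 / 2)

open scoped RealInnerProductSpace

section GaussianIntegrals

variable {N : ℕ}

lemma gaussDensity_pos (b x : EuclideanSpace ℝ (Fin N)) : 0 < gaussDensity N b x := by
  unfold gaussDensity
  positivity

lemma integrable_exp_neg_half_norm_sq_add_inner (d : EuclideanSpace ℝ (Fin N)) :
    Integrable (fun y : EuclideanSpace ℝ (Fin N) ↦ Real.exp (-‖y‖ ^ 2 / 2 + ⟪d, y⟫)) := by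
  have h := (GaussianFourier.integrable_cexp_neg_mul_sq_norm_add
    (b := ((1 / 2 : ℝ) : ℂ)) (by simp) 1 d).norm
  refine h.congr (Filter.Eventually.of_forall fun y ↦ ?_)
  simp only [Complex.norm_exp]
  congr 1
  have : (-((1 / 2 : ℝ) : ℂ) * (‖y‖ : ℂ) ^ 2 + 1 * ((⟪d, y⟫ : ℝ) : ℂ)) =
      ((-‖y‖ ^ 2 / 2 + ⟪d, y⟫ : ℝ) : ℂ) := by
    push_cast
    ring
  rw [this, Complex.ofReal_re]

lemma integrable_gaussDensity_zero : Integrable (gaussDensity N 0) := by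
  have h := (integrable_exp_neg_half_norm_sq_add_inner (0 : EuclideanSpace ℝ (Fin N))).const_mul
    ((2 * Real.pi) ^ (-(N : ℝ) / 2))
  refine h.congr (Filter.Eventually.of_forall fun y ↦ ?_)
  simp [gaussDensity]

lemma integral_gaussDensity_zero : ∫ y, gaussDensity N 0 y = 1 := by
  have h := GaussianFourier.integral_rexp_neg_mul_sq_norm
    (V := EuclideanSpace ℝ (Fin N)) (b := 1 / 2) (by norm_num)
  have h' : ∀ y : EuclideanSpace ℝ (Fin N), gaussDensity N 0 y =
      (2 * Real.pi) ^ (-(N : ℝ) / 2) * Real.exp (-(1 / 2) * ‖y‖ ^ 2) := by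
    intro y
    rw [gaussDensity, sub_zero]
    ring_nf
  simp_rw [h']
  rw [integral_const_mul, h, finrank_euclideanSpace_fin,
    show Real.pi / (1 / 2) = 2 * Real.pi by ring, ← Real.rpow_add (by positivity)]
  ring_nf
  exact Real.rpow_zero _

lemma integrable_gaussDensity_zero_mul_inner (d : EuclideanSpace ℝ (Fin N)) :
    Integrable (fun y ↦ gaussDensity N 0 y * ⟪d, y⟫) := by
  have h := ((integrable_exp_neg_half_norm_sq_add_inner d).add
    (integrable_exp_neg_half_norm_sq_add_inner (-d))).const_mul ((2 * Real.pi) ^ (-(N : ℝ) / 2))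
  refine h.mono' (Continuous.aestronglyMeasurable (by unfold gaussDensity; fun_prop))
    (Filter.Eventually.of_forall fun y ↦ ?_)
  rw [norm_mul, Real.norm_of_nonneg (gaussDensity_pos 0 y).le, Real.norm_eq_abs, gaussDensity,
    sub_zero]
  simp only [Pi.add_apply, inner_neg_left, Real.exp_add]
  rw [← mul_add, mul_assoc]
  gcongr
  have h₁ := Real.add_one_le_exp ⟪d, y⟫
  have h₂ := Real.add_one_le_exp (-⟪d, y⟫)
  have h₃ := Real.exp_pos ⟪d, y⟫
  have h₄ := Real.exp_pos (-⟪d, y⟫)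
  rw [abs_le]
  constructor <;> linarith

lemma integral_gaussDensity_zero_mul_inner (d : EuclideanSpace ℝ (Fin N)) :
    ∫ y, gaussDensity N 0 y * ⟪d, y⟫ = 0 := by
  have h := integral_neg_eq_self (fun y ↦ gaussDensity N 0 y * ⟪d, y⟫) volume
  have h' : ∀ y, gaussDensity N 0 (-y) * ⟪d, -y⟫ = -(gaussDensity N 0 y * ⟪d, y⟫) := by
    intro y
    simp [gaussDensity]
  simp_rw [h', integral_neg] at h
  linarith

/-- The Kullback–Leibler divergence between two weighted unit Gaussians. -/
lemma integral_weighted_gaussDensity_mul_log {p q : ℝ} (hp : 0 < p) (hq : 0 < q)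
    (b₀ b : EuclideanSpace ℝ (Fin N)) :
    ∫ x, p * gaussDensity N b₀ x *
        Real.log (p * gaussDensity N b₀ x / (q * gaussDensity N b x)) =
      p * Real.log (p / q) + p * ‖b - b₀‖ ^ 2 / 2 := by
  rw [← integral_add_right_eq_self _ b₀]
  have h : ∀ y, p * gaussDensity N b₀ (y + b₀) *
        Real.log (p * gaussDensity N b₀ (y + b₀) / (q * gaussDensity N b (y + b₀))) =
      (p * Real.log (p / q) + p * ‖b - b₀‖ ^ 2 / 2) * gaussDensity N 0 y -
        p * (gaussDensity N 0 y * ⟪b - b₀, y⟫) := by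
    intro y
    have hshift : gaussDensity N b₀ (y + b₀) = gaussDensity N 0 y := by simp [gaussDensity]
    have hnorm : ‖y + b₀ - b‖ ^ 2 = ‖y‖ ^ 2 - 2 * ⟪b - b₀, y⟫ + ‖b - b₀‖ ^ 2 := by
      rw [show y + b₀ - b = y - (b - b₀) by abel, norm_sub_sq_real, real_inner_comm]
    have hlog : Real.log (gaussDensity N 0 y) - Real.log (gaussDensity N b (y + b₀)) =
        ‖b - b₀‖ ^ 2 / 2 - ⟪b - b₀, y⟫ := by
      unfold gaussDensity
      rw [Real.log_mul (by positivity) (by positivity),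
        Real.log_mul (by positivity) (by positivity), Real.log_exp, Real.log_exp, hnorm, sub_zero]
      ring
    rw [hshift, Real.log_div (mul_pos hp (gaussDensity_pos _ _)).ne'
      (mul_pos hq (gaussDensity_pos _ _)).ne', Real.log_mul hp.ne' (gaussDensity_pos _ _).ne',
      Real.log_mul hq.ne' (gaussDensity_pos _ _).ne', Real.log_div hp.ne' hq.ne']
    linear_combination p * gaussDensity N 0 y * hlog
  simp_rw [h]
  rw [integral_sub (integrable_gaussDensity_zero.const_mul _)
    ((integrable_gaussDensity_zero_mul_inner _).const_mul _), integral_const_mul,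
    integral_const_mul, integral_gaussDensity_zero, integral_gaussDensity_zero_mul_inner]
  ring

end GaussianIntegrals

lemma sq_sub_div_four_le_mul_log_div {p q : ℝ} (hp : 0 < p) (hq : 0 < q) (hp1 : p ≤ 1)
    (hq1 : q ≤ 1) : (q - p) ^ 2 / 4 ≤ p * Real.log (p / q) + q - p := by
  obtain ⟨u, hu, rfl⟩ : ∃ u, 0 < u ∧ p = u ^ 2 := ⟨√p, by positivity, (Real.sq_sqrt hp.le).symm⟩
  obtain ⟨v, hv, rfl⟩ : ∃ v, 0 < v ∧ q = v ^ 2 := ⟨√q, by positivity, (Real.sq_sqrt hq.le).symm⟩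
  have hu1 : u ≤ 1 := by nlinarith
  have hv1 : v ≤ 1 := by nlinarith
  have hlog := Real.one_sub_inv_le_log_of_pos (div_pos hu hv)
  have hmul : u ^ 2 * (1 - (u / v)⁻¹) = u ^ 2 - u * v := by field_simp
  have hge := mul_le_mul_of_nonneg_left hlog (sq_nonneg u)
  rw [← div_pow, Real.log_pow]
  have hsq : (u + v) ^ 2 ≤ 4 := by nlinarith
  have := mul_le_mul_of_nonneg_left hsq (sq_nonneg (v - u))
  push_cast
  nlinarith

lemma mul_log_div_le_sq_sub_div {p q : ℝ} (hp : 0 < p) (hq : 0 < q) :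
    p * Real.log (p / q) + q - p ≤ (q - p) ^ 2 / q := by
  have hlog := mul_le_mul_of_nonneg_left (Real.log_le_sub_one_of_pos (div_pos hp hq)) hp.le
  have : (q - p) ^ 2 / q = p * (p / q - 1) + q - p := by
    field_simp
    ring
  linarith

/-- near the true parameter (with the redundant mixing ratios near 0), the
complete-data Kullback–Leibler divergence `H_XY` of the Gaussian mixture is equivalent to
`Ĥ(w) = Σ_{k=2}^{K*}(a_k−a*_k)² + Σ_{k=K*+1}^{K} a_k + Σ_{k=1}^{K*}‖b_k−b*_k‖²`.
Components are indexed by `k ∈ {1, …, K}`. -/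
theorem gaussian_complete_KL_equivalent_form
    (N Kstar K : ℕ) (hKstar : 1 ≤ Kstar) (hK : Kstar < K)
    (astar : ℕ → ℝ) (hastar_pos : ∀ k ∈ Finset.Icc 1 Kstar, 0 < astar k)
    (hastar_sum : ∑ k ∈ Finset.Icc 1 Kstar, astar k = 1)
    (bstar : ℕ → EuclideanSpace ℝ (Fin N)) :
    ∃ ε > (0 : ℝ), ∃ c C : ℝ, 0 < c ∧ c ≤ C ∧
      ∀ (a : ℕ → ℝ) (b : ℕ → EuclideanSpace ℝ (Fin N)),
        (∀ k ∈ Finset.Icc 1 K, 0 < a k) →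
        (∑ k ∈ Finset.Icc 1 K, a k = 1) →
        (∀ k ∈ Finset.Icc 2 Kstar, |a k - astar k| < ε) →
        (∀ k ∈ Finset.Icc (Kstar + 1) K, a k < ε) →
        (∀ k ∈ Finset.Icc 1 Kstar, ‖b k - bstar k‖ < ε) →
        c * (∑ k ∈ Finset.Icc 2 Kstar, (a k - astar k) ^ 2 +
              ∑ k ∈ Finset.Icc (Kstar + 1) K, a k +
              ∑ k ∈ Finset.Icc 1 Kstar, ‖b k - bstar k‖ ^ 2) ≤
            (∑ k ∈ Finset.Icc 1 Kstar, ∫ x : EuclideanSpace ℝ (Fin N),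
              astar k * gaussDensity N (bstar k) x *
                Real.log (astar k * gaussDensity N (bstar k) x /
                  (a k * gaussDensity N (b k) x))) ∧
          (∑ k ∈ Finset.Icc 1 Kstar, ∫ x : EuclideanSpace ℝ (Fin N),
              astar k * gaussDensity N (bstar k) x *
                Real.log (astar k * gaussDensity N (bstar k) x /
                  (a k * gaussDensity N (b k) x))) ≤
            C * (∑ k ∈ Finset.Icc 2 Kstar, (a k - astar k) ^ 2 +
              ∑ k ∈ Finset.Icc (Kstar + 1) K, a k +
              ∑ k ∈ Finset.Icc 1 Kstar, ‖b k - bstar k‖ ^ 2) := by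
  obtain ⟨k₀, hk₀, hmin⟩ := (Finset.Icc 1 Kstar).exists_min_image astar ⟨1, by simp; omega⟩
  obtain ⟨m, hm⟩ : ∃ m, m = astar k₀ := ⟨_, rfl⟩
  rw [← hm] at hmin
  have hm0 : 0 < m := hm ▸ hastar_pos k₀ hk₀
  have hK0 : (0 : ℝ) < K := by exact_mod_cast (by omega : 0 < K)
  have hsplit : ∀ f : ℕ → ℝ, ∑ k ∈ Finset.Icc 1 Kstar, f k =
      f 1 + ∑ k ∈ Finset.Icc 2 Kstar, f k := by
    intro f
    rw [show Finset.Icc 1 Kstar = insert 1 (Finset.Icc 2 Kstar) by ext; simp; omega,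
      Finset.sum_insert (by simp)]
  have hunion : ∀ f : ℕ → ℝ, ∑ k ∈ Finset.Icc 1 K, f k =
      ∑ k ∈ Finset.Icc 1 Kstar, f k + ∑ k ∈ Finset.Icc (Kstar + 1) K, f k := by
    intro f
    rw [← Finset.sum_union (by rw [Finset.disjoint_left]; intro k; simp; omega)]
    congr 1
    ext
    simp
    omega
  have hle1 : ∀ k ∈ Finset.Icc 1 Kstar, astar k ≤ 1 := fun k hk ↦ hastar_sum ▸
    Finset.single_le_sum (f := astar) (fun i hi ↦ (hastar_pos i hi).le) hk
  refine ⟨m / (2 * K), by positivity, min (1 / 4) (m / 2), (2 / m) * (2 * K + 2) + 1,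
    by positivity, ?_, ?_⟩
  · have : 0 ≤ (2 / m) * (2 * K + 2) := by positivity
    linarith [min_le_left (1 / 4) (m / 2)]
  intro a b ha hasum hnear hsmall _
  have hmem : ∀ k ∈ Finset.Icc 1 Kstar, k ∈ Finset.Icc 1 K := by
    intro k hk
    simp only [Finset.mem_Icc] at hk ⊢
    omega
  have ha1 : ∀ k ∈ Finset.Icc 1 K, a k ≤ 1 := fun k hk ↦ hasum ▸
    Finset.single_le_sum (f := a) (fun i hi ↦ (ha i hi).le) hk
  rw [Finset.sum_congr rfl fun k hk ↦ integral_weighted_gaussDensity_mul_log (hastar_pos k hk)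
    (ha k (hmem k hk)) (bstar k) (b k)]
  obtain ⟨Q, hQ⟩ : ∃ Q, Q = ∑ k ∈ Finset.Icc 2 Kstar, (a k - astar k) ^ 2 := ⟨_, rfl⟩
  obtain ⟨S, hS⟩ : ∃ S, S = ∑ k ∈ Finset.Icc (Kstar + 1) K, a k := ⟨_, rfl⟩
  obtain ⟨B, hB⟩ : ∃ B, B = ∑ k ∈ Finset.Icc 1 Kstar, ‖b k - bstar k‖ ^ 2 := ⟨_, rfl⟩
  obtain ⟨D, hD⟩ : ∃ D, D = ∑ k ∈ Finset.Icc 2 Kstar, (a k - astar k) := ⟨_, rfl⟩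
  obtain ⟨Φ, hΦ⟩ : ∃ Φ, Φ = ∑ k ∈ Finset.Icc 1 Kstar,
    (astar k * Real.log (astar k / a k) + a k - astar k) := ⟨_, rfl⟩
  obtain ⟨R, hR⟩ : ∃ R, R = ∑ k ∈ Finset.Icc 1 Kstar, astar k * ‖b k - bstar k‖ ^ 2 / 2 :=
    ⟨_, rfl⟩
  have hQ0 : 0 ≤ Q := hQ ▸ Finset.sum_nonneg fun k _ ↦ sq_nonneg _
  have hB0 : 0 ≤ B := hB ▸ Finset.sum_nonneg fun k _ ↦ sq_nonneg _
  have hS0 : 0 ≤ S := hS ▸ Finset.sum_nonneg fun k hk ↦ (ha k (by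
    simp only [Finset.mem_Icc] at hk ⊢; omega)).le
  have hsum : ∑ k ∈ Finset.Icc 1 Kstar, a k + S = 1 := by rw [hS, ← hunion, hasum]
  have hS1 : S ≤ 1 := by
    linarith [Finset.sum_nonneg fun k hk ↦ (ha k (hmem k hk)).le]
  have hH : ∑ k ∈ Finset.Icc 1 Kstar, (astar k * Real.log (astar k / a k) +
      astar k * ‖b k - bstar k‖ ^ 2 / 2) = Φ + S + R := by
    rw [hΦ, hR, Finset.sum_sub_distrib, Finset.sum_add_distrib, Finset.sum_add_distrib, hastar_sum]
    linarith
  have hfirst : a 1 - astar 1 = -(D + S) := by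
    have h₁ := hsplit a
    have h₂ := hsplit astar
    rw [hD, Finset.sum_sub_distrib]
    linarith
  have hlower : ∀ k ∈ Finset.Icc 1 Kstar,
      (a k - astar k) ^ 2 / 4 ≤ astar k * Real.log (astar k / a k) + a k - astar k :=
    fun k hk ↦ sq_sub_div_four_le_mul_log_div (hastar_pos k hk) (ha k (hmem k hk)) (hle1 k hk)
      (ha1 k (hmem k hk))
  have hsumsq : ∑ k ∈ Finset.Icc 1 Kstar, (a k - astar k) ^ 2 = (a 1 - astar 1) ^ 2 + Q := by
    rw [hsplit, hQ]
  have hΦlower : Q / 4 ≤ Φ := by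
    have := Finset.sum_le_sum hlower
    rw [← hΦ, ← Finset.sum_div, hsumsq] at this
    linarith [sq_nonneg (a 1 - astar 1)]
  have hRlower : m / 2 * B ≤ R := by
    rw [hB, hR, Finset.mul_sum]
    refine Finset.sum_le_sum fun k hk ↦ ?_
    nlinarith [mul_le_mul_of_nonneg_right (hmin k hk) (sq_nonneg ‖b k - bstar k‖)]
  have hRupper : R ≤ B := by
    rw [hB, hR]
    refine Finset.sum_le_sum fun k hk ↦ ?_
    nlinarith [mul_le_mul_of_nonneg_right (hle1 k hk) (sq_nonneg ‖b k - bstar k‖),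
      sq_nonneg ‖b k - bstar k‖]
  have hDS : |D + S| ≤ m / 2 := by
    have h₁ : |D| ≤ ((Finset.Icc 2 Kstar).card : ℝ) * (m / (2 * K)) := by
      rw [hD, ← nsmul_eq_mul]
      exact (Finset.abs_sum_le_sum_abs _ _).trans
        (Finset.sum_le_card_nsmul _ _ _ fun k hk ↦ (hnear k hk).le)
    have h₂ : S ≤ ((Finset.Icc (Kstar + 1) K).card : ℝ) * (m / (2 * K)) := by
      rw [hS, ← nsmul_eq_mul]
      exact Finset.sum_le_card_nsmul _ _ _ fun k hk ↦ (hsmall k hk).le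
    have hcard : ((Finset.Icc 2 Kstar).card : ℝ) + (Finset.Icc (Kstar + 1) K).card ≤ K := by
      norm_cast
      simp only [Nat.card_Icc]
      omega
    have h₃ := mul_le_mul_of_nonneg_right hcard (by positivity : 0 ≤ m / (2 * K))
    have h₄ : (K : ℝ) * (m / (2 * K)) = m / 2 := by field_simp
    calc |D + S| ≤ |D| + |S| := abs_add_le D S
      _ = |D| + S := by rw [abs_of_nonneg hS0]
      _ ≤ m / 2 := by linarith
  have hhalf : ∀ k ∈ Finset.Icc 1 Kstar, m / 2 ≤ a k := by
    intro k hk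
    have hmk := hmin k hk
    have hdist : |a k - astar k| ≤ m / 2 := by
      rcases eq_or_ne k 1 with rfl | hk1
      · rwa [hfirst, abs_neg]
      · refine (hnear k (by simp only [Finset.mem_Icc] at hk ⊢; omega)).le.trans ?_
        have : (1 : ℝ) ≤ K := by exact_mod_cast (by omega : 1 ≤ K)
        gcongr
        linarith
    linarith [(abs_le.mp hdist).1]
  have hDsq : D ^ 2 ≤ K * Q := by
    have h := sq_sum_le_card_mul_sum_sq (s := Finset.Icc 2 Kstar) (f := fun k ↦ a k - astar k)
    rw [← hD, ← hQ] at h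
    refine h.trans (mul_le_mul_of_nonneg_right ?_ hQ0)
    norm_cast
    simp only [Nat.card_Icc]
    omega
  have hΦupper : Φ ≤ 2 / m * (2 * K * Q + 2 * S + Q) := by
    calc Φ ≤ ∑ k ∈ Finset.Icc 1 Kstar, 2 / m * (a k - astar k) ^ 2 := by
          rw [hΦ]
          refine Finset.sum_le_sum fun k hk ↦ (mul_log_div_le_sq_sub_div (hastar_pos k hk)
            (ha k (hmem k hk))).trans ?_
          calc (a k - astar k) ^ 2 / a k ≤ (a k - astar k) ^ 2 / (m / 2) := by
                gcongr
                exact hhalf k hk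
            _ = 2 / m * (a k - astar k) ^ 2 := by field_simp
      _ ≤ 2 / m * (2 * K * Q + 2 * S + Q) := by
          rw [← Finset.mul_sum, hsumsq, hfirst]
          gcongr
          nlinarith [sq_nonneg (D - S), mul_le_mul_of_nonneg_left hS1 hS0]
  rw [hH, ← hQ, ← hS, ← hB]
  constructor
  · have h₁ := min_le_left (1 / 4) (m / 2)
    have h₂ := min_le_right (1 / 4) (m / 2)
    nlinarith [mul_le_mul_of_nonneg_right h₁ hQ0, mul_le_mul_of_nonneg_right h₁ hS0,
      mul_le_mul_of_nonneg_right h₂ hB0]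
  · have hinv : 0 < 2 / m := by positivity
    nlinarith [mul_nonneg hinv.le hQ0, mul_nonneg hinv.le hS0, mul_nonneg hinv.le hB0,
      mul_nonneg (mul_nonneg hinv.le hK0.le) hS0, mul_nonneg (mul_nonneg hinv.le hK0.le) hB0]
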